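/- For any $k$-permutation $\pi$ and any doubly stochastic $n \times n$ matrix $M$, the density of $\pi$ in the step permuton $\mu[M]$ is given by $d(\pi, \mu[M]) = \frac{k!}{n^k}\sum_{f,g:[k]\nearrow[n]} \frac{1}{\prod_{i\in[n]}|f^{-1}(i)|!\,|g^{-1}(i)|!} \prod_{m\in[k]} M_{f(m),g(\pi(m))}$, where the sum is over pairs of non-decreasing functions $f, g:[k]\to[n]$. In the special case where $M = \CM$ is the constant matrix with entries $1/n$, this value equals $1/k!$. -/

import Mathlib

open MeasureTheory
open scoped Classical

/-- The step permuton `μ[M]` associated with an `n × n` matrix `M`: the measure on `ℝ²`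
with density `∑_{i,j} n·M_{i,j} · 1_{[i/n,(i+1)/n) × [j/n,(j+1)/n)}` (0-indexed tiles of
`[0,1]²`) with respect to Lebesgue measure. -/
noncomputable def stepPermuton (n : ℕ) (M : Matrix (Fin n) (Fin n) ℝ) :
    Measure (ℝ × ℝ) :=
  volume.withDensity (fun p =>
    ∑ i : Fin n, ∑ j : Fin n,
      (if p.1 ∈ Set.Ico ((i : ℝ) / n) (((i : ℝ) + 1) / n)
          ∧ p.2 ∈ Set.Ico ((j : ℝ) / n) (((j : ℝ) + 1) / n)
        then ENNReal.ofReal ((n : ℝ) * M i j) else 0))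

/-- The set of `k`-tuples of points of `ℝ²` inducing the pattern `π`: after sorting by
`x`-coordinate (via some permutation `σ`), the `y`-coordinates compare according to `π`. -/
def patternSet (k : ℕ) (π : Equiv.Perm (Fin k)) : Set (Fin k → ℝ × ℝ) :=
  {p | ∃ σ : Equiv.Perm (Fin k), StrictMono (fun a => (p (σ a)).1) ∧
        ∀ a b : Fin k, ((p (σ a)).2 < (p (σ b)).2 ↔ π a < π b)}

/-- The pattern density `d(π, μ)`: the probability that `k` independent samples from `μ`
induce the pattern `π`. -/
noncomputable def density (k n : ℕ) (π : Equiv.Perm (Fin k))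
    (M : Matrix (Fin n) (Fin n) ℝ) : ℝ :=
  ((Measure.pi fun _ : Fin k => stepPermuton n M) (patternSet k π)).toReal

open scoped NNReal ENNReal

lemma measurePreserving_comp_perm {ι α : Type*} [Fintype ι] [MeasurableSpace α]
    (ν : Measure α) [SigmaFinite ν] (σ : Equiv.Perm ι) :
    MeasurePreserving (fun p : ι → α => p ∘ σ)
      (Measure.pi fun _ => ν) (Measure.pi fun _ => ν) where
  measurable := by
    refine measurable_pi_iff.mpr fun i => measurable_pi_apply (σ i)
  map_eq := by
    refine (Measure.pi_eq fun s hs => ?_).symm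
    have hm : Measurable fun p : ι → α => p ∘ σ :=
      measurable_pi_iff.mpr fun i => measurable_pi_apply (σ i)
    rw [Measure.map_apply hm (MeasurableSet.univ_pi hs)]
    have : (fun p : ι → α => p ∘ σ) ⁻¹' (Set.univ.pi s)
        = Set.univ.pi fun i => s (σ.symm i) := by
      ext p
      simp only [Set.mem_preimage, Set.mem_pi, Set.mem_univ, true_imp_iff, Function.comp]
      exact ⟨fun h i => by simpa using h (σ.symm i), fun h i => by simpa using h (σ i)⟩
    rw [this, Measure.pi_pi]
    exact Equiv.prod_comp σ.symm fun i => ν (s i)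

lemma pi_biUnion_perm {ι α : Type*} [Fintype ι] [MeasurableSpace α]
    (ν : Measure α) [SigmaFinite ν] (Γ : Finset (Equiv.Perm ι)) {A : Set (ι → α)}
    (hA : MeasurableSet A)
    (hd : ∀ (p : ι → α) (σ τ : Equiv.Perm ι), p ∘ σ ∈ A → p ∘ τ ∈ A → σ = τ) :
    (Measure.pi fun _ => ν) (⋃ σ ∈ Γ, {p | p ∘ σ ∈ A})
      = Γ.card * (Measure.pi fun _ => ν) A := by
  rw [measure_biUnion_finset]
  · simp_rw [show ∀ σ : Equiv.Perm ι, (Measure.pi fun _ => ν) {p : ι → α | p ∘ σ ∈ A}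
        = (Measure.pi fun _ => ν) A from
      fun σ => (measurePreserving_comp_perm ν σ).measure_preimage hA.nullMeasurableSet]
    simp
  · intro σ _ τ _ hne
    exact Set.disjoint_left.mpr fun p hp hq => hne (hd p σ τ hp hq)
  · intro σ _
    exact (measurePreserving_comp_perm ν σ).measurable hA

/-- A product measure splits along the boxes built from a partition of the base space. -/
lemma pi_eq_sum_boxes {κ α ι : Type*} [Fintype κ] [DecidableEq κ] [Fintype ι] [MeasurableSpace α]
    (ν : Measure α) [SigmaFinite ν] (T : ι → Set α) (hT : ∀ i, MeasurableSet (T i))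
    (hd : ∀ i j x, x ∈ T i → x ∈ T j → i = j) (hν : ∀ᵐ x ∂ν, ∃ i, x ∈ T i)
    {A : Set (κ → α)} (hA : MeasurableSet A) :
    (Measure.pi fun _ => ν) A
      = ∑ h : κ → ι, (Measure.pi fun _ => ν) (Set.univ.pi (fun m => T (h m)) ∩ A) := by
  have hae : ∀ᵐ p ∂(Measure.pi fun _ : κ => ν), ∀ m, ∃ i, p m ∈ T i := by
    rw [ae_all_iff]
    exact fun m =>
      (Measure.tendsto_eval_ae_ae (μ := fun _ : κ => ν) (i := m)).eventually hν
  have hU : (A : Set (κ → α)) =ᵐ[Measure.pi fun _ : κ => ν]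
      ⋃ h : κ → ι, Set.univ.pi (fun m => T (h m)) ∩ A := by
    filter_upwards [hae] with p hp
    choose h hh using hp
    refine propext ⟨fun hpA => Set.mem_iUnion.mpr ⟨h, fun m _ => hh m, hpA⟩, fun hp => ?_⟩
    obtain ⟨_, hq⟩ := Set.mem_iUnion.mp hp
    exact hq.2
  rw [measure_congr hU, measure_iUnion, tsum_fintype]
  · intro f g hne
    refine Set.disjoint_left.mpr fun p hp hq => hne (funext fun m => ?_)
    exact hd _ _ _ (hp.1 m trivial) (hq.1 m trivial)
  · exact fun h => (MeasurableSet.univ_pi fun m => hT (h m)).inter hA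

lemma pi_smul_nnreal {κ α : Type*} [Fintype κ] [MeasurableSpace α]
    (ν : κ → Measure α) [∀ i, SigmaFinite (ν i)] (c : κ → ℝ≥0) :
    Measure.pi (fun m => c m • ν m) = (∏ m, c m) • Measure.pi ν := by
  refine Measure.pi_eq fun s _ => ?_
  simp only [Measure.smul_apply, Measure.pi_pi, ENNReal.smul_def, smul_eq_mul,
    Finset.prod_mul_distrib, ENNReal.ofNNReal_finsetProd]

lemma StrictMono.perm_eq_of_comp {α : Type*} [LinearOrder α] {k : ℕ} {x : Fin k → α}
    {σ τ : Equiv.Perm (Fin k)} (hσ : StrictMono (x ∘ σ)) (hτ : StrictMono (x ∘ τ)) : σ = τ := by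
  have h := Tuple.unique_monotone hσ.monotone hτ.monotone
  have hx : Function.Injective x := by
    intro a b hab
    have := hσ.injective (a₁ := σ.symm a) (a₂ := σ.symm b) (by simpa using hab)
    simpa using this
  exact Equiv.ext fun a => hx (congrFun h a)

lemma measurableSet_strictMono {k : ℕ} : MeasurableSet {x : Fin k → ℝ | StrictMono x} := by
  have : {x : Fin k → ℝ | StrictMono x} = ⋂ a, ⋂ b, {x | a < b → x a < x b} := by
    ext x; simp [StrictMono]
  rw [this]
  refine MeasurableSet.iInter fun a => MeasurableSet.iInter fun b => ?_
  by_cases h : a < b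
  · simpa [h] using measurableSet_lt (measurable_pi_apply a) (measurable_pi_apply b)
  · simp [h]

lemma ae_injective_volume (k : ℕ) : ∀ᵐ x : Fin k → ℝ, Function.Injective x := by
  have : ∀ a b : Fin k, a ≠ b → ∀ᵐ x : Fin k → ℝ, x a ≠ x b := by
    intro a b hab
    let V : Submodule ℝ (Fin k → ℝ) :=
      LinearMap.ker (LinearMap.proj (R := ℝ) (φ := fun _ : Fin k => ℝ) a - LinearMap.proj b)
    have hV : V ≠ ⊤ := by
      intro h
      have : (Pi.single a 1 : Fin k → ℝ) ∈ V := h ▸ trivial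
      simp [V, hab.symm] at this
    have h0 := Measure.addHaar_submodule (volume : Measure (Fin k → ℝ)) V hV
    filter_upwards [measure_eq_zero_iff_ae_notMem.mp h0] with x hx hxy
    exact hx (by simp [V, hxy])
  have h2 : ∀ᵐ x : Fin k → ℝ, ∀ a b : Fin k, a ≠ b → x a ≠ x b := by
    simpa only [ae_all_iff] using this
  filter_upwards [h2] with x hx a b hab
  by_contra hne
  exact hx a b hne hab

/-- The `i`-th of the `n` equal half-open intervals subdividing `[0, 1)`. -/
def unitTile (n : ℕ) (i : Fin n) : Set ℝ := Set.Ico ((i : ℝ) / n) (((i : ℝ) + 1) / n)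

lemma volume_unitTile {n : ℕ} (i : Fin n) : volume (unitTile n i) = (n : ℝ≥0∞)⁻¹ := by
  have hn : (0 : ℝ) < n := by exact_mod_cast i.pos
  rw [unitTile, Real.volume_Ico, ← sub_div, add_sub_cancel_left, one_div,
    ENNReal.ofReal_inv_of_pos hn, ENNReal.ofReal_natCast]

lemma unitTile_index_le {n : ℕ} {i j : Fin n} {x y : ℝ} (hx : x ∈ unitTile n i)
    (hy : y ∈ unitTile n j) (hxy : x ≤ y) : i ≤ j := by
  have hn : (0 : ℝ) < n := by exact_mod_cast i.pos
  have h : (i : ℝ) / n < ((j : ℝ) + 1) / n := (hx.1.trans hxy).trans_lt hy.2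
  rw [div_lt_div_iff_of_pos_right hn] at h
  have : (i : ℕ) < j + 1 := by exact_mod_cast h
  exact Fin.le_def.mpr (by omega)

lemma unitTile_index_eq {n : ℕ} {i j : Fin n} {x : ℝ} (hx : x ∈ unitTile n i)
    (hy : x ∈ unitTile n j) : i = j :=
  le_antisymm (unitTile_index_le hx hy le_rfl) (unitTile_index_le hy hx le_rfl)

lemma measurableSet_unitTile {n : ℕ} (i : Fin n) : MeasurableSet (unitTile n i) :=
  measurableSet_Ico

lemma exists_mem_unitTile_iff {n : ℕ} (hn : 1 ≤ n) {x : ℝ} :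
    (∃ i, x ∈ unitTile n i) ↔ x ∈ Set.Ico (0 : ℝ) 1 := by
  have hn' : (0 : ℝ) < n := by exact_mod_cast hn
  constructor
  · rintro ⟨i, h1, h2⟩
    refine ⟨le_trans (by positivity) h1, h2.trans_le ?_⟩
    rw [div_le_one hn']
    exact_mod_cast i.isLt
  · rintro ⟨h0, h1⟩
    have hx : 0 ≤ x * n := by positivity
    refine ⟨⟨⌊x * n⌋₊, (Nat.floor_lt hx).mpr (by nlinarith)⟩, ?_, ?_⟩
    · rw [div_le_iff₀ hn']; exact Nat.floor_le hx
    · rw [lt_div_iff₀ hn']; exact Nat.lt_floor_add_one _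

/-- Increasing points whose `m`-th coordinate lies in the tile of index `f m`. -/
def increasingBox {k n : ℕ} (f : Fin k → Fin n) : Set (Fin k → ℝ) :=
  Set.univ.pi (fun m => unitTile n (f m)) ∩ {x | StrictMono x}

lemma measurableSet_increasingBox {k n : ℕ} (f : Fin k → Fin n) :
    MeasurableSet (increasingBox f) :=
  (MeasurableSet.univ_pi fun _ => measurableSet_unitTile _).inter measurableSet_strictMono

lemma increasingBox_eq_empty {k n : ℕ} {f : Fin k → Fin n} (hf : ¬ Monotone f) :
    increasingBox f = ∅ := by
  refine Set.eq_empty_of_forall_notMem fun x hx => hf fun a b hab => ?_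
  exact unitTile_index_le (hx.1 a trivial) (hx.1 b trivial) (hx.2.monotone hab)

/-- The product of the factorials of the fibre sizes of `f`. -/
def fiberFactorial {k n : ℕ} (f : Fin k → Fin n) : ℕ :=
  ∏ i : Fin n, (Finset.univ.filter (fun m => f m = i)).card.factorial

lemma fiberFactorial_pos {k n : ℕ} (f : Fin k → Fin n) : 0 < fiberFactorial f :=
  Finset.prod_pos fun _ _ => Nat.factorial_pos _

lemma card_perm_comp_eq {k n : ℕ} (f : Fin k → Fin n) :
    (Finset.univ.filter (fun σ : Equiv.Perm (Fin k) => f ∘ σ = f)).card = fiberFactorial f := by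
  have h := DomMulAct.stabilizer_card f
  rw [Fintype.card_subtype] at h
  rw [fiberFactorial]
  convert h using 3 with i
  rw [Fintype.card_subtype]

lemma volume_increasingBox {k n : ℕ} {f : Fin k → Fin n} (hf : Monotone f) :
    volume (increasingBox f) = ((n : ℝ≥0∞) ^ k)⁻¹ * (fiberFactorial f : ℝ≥0∞)⁻¹ := by
  have hbox : volume (Set.univ.pi fun m => unitTile n (f m)) = ((n : ℝ≥0∞) ^ k)⁻¹ := by
    rw [volume_pi_pi]
    simp [volume_unitTile, ENNReal.inv_pow]
  have hae : (Set.univ.pi fun m => unitTile n (f m)) =ᵐ[volume]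
      ⋃ σ ∈ Finset.univ.filter (fun σ : Equiv.Perm (Fin k) => f ∘ σ = f),
        {x : Fin k → ℝ | x ∘ σ ∈ increasingBox f} := by
    filter_upwards [ae_injective_volume k] with x hx
    apply propext
    change x ∈ Set.univ.pi (fun m => unitTile n (f m)) ↔ x ∈ ⋃ σ ∈ _, _
    simp only [Set.mem_iUnion, Finset.mem_filter, Finset.mem_univ, true_and, exists_prop,
      Set.mem_ofPred_eq]
    constructor
    · intro hxf
      have hs : StrictMono (x ∘ Tuple.sort x) :=
        (Tuple.monotone_sort x).strictMono_of_injective (hx.comp (Tuple.sort x).injective)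
      have hm : Monotone (f ∘ Tuple.sort x) := fun a b hab =>
        unitTile_index_le (hxf _ trivial) (hxf _ trivial) (hs.monotone hab)
      have hfs : f ∘ Tuple.sort x = f :=
        Tuple.unique_monotone (τ := Equiv.refl _) hm hf
      refine ⟨_, hfs, fun m _ => ?_, hs⟩
      have := hxf (Tuple.sort x m) trivial
      dsimp only at this
      rwa [show f (Tuple.sort x m) = f m from congrFun hfs m] at this
    · rintro ⟨σ, hσ, h, -⟩ m -
      have := h (σ.symm m) trivial
      have h2 := congrFun hσ (σ.symm m)
      simp only [Function.comp, Equiv.apply_symm_apply] at this h2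
      rwa [← h2] at this
  have key := pi_biUnion_perm (volume : Measure ℝ)
    (Finset.univ.filter (fun σ : Equiv.Perm (Fin k) => f ∘ σ = f))
    (measurableSet_increasingBox f) fun p σ τ h1 h2 => StrictMono.perm_eq_of_comp h1.2 h2.2
  rw [← volume_pi, ← measure_congr hae, hbox, card_perm_comp_eq] at key
  rw [key, mul_comm, ← mul_assoc, ENNReal.inv_mul_cancel, one_mul]
  · exact_mod_cast (fiberFactorial_pos f).ne'
  · exact ENNReal.natCast_ne_top _

lemma sum_volume_increasingBox (k n : ℕ) (hn : 1 ≤ n) :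
    ∑ f : Fin k → Fin n, volume (increasingBox f) = (k.factorial : ℝ≥0∞)⁻¹ := by
  have h : ∀ n : ℕ, 1 ≤ n → ∑ f : Fin k → Fin n, volume (increasingBox f)
      = (Measure.pi fun _ : Fin k => (volume : Measure ℝ).restrict (Set.Ico 0 1))
          {x | StrictMono x} := by
    intro n hn
    rw [pi_eq_sum_boxes _ (unitTile n) measurableSet_unitTile
      (fun i j x => unitTile_index_eq)
      (by
        filter_upwards [ae_restrict_mem measurableSet_Ico] with x hx
        exact (exists_mem_unitTile_iff hn).mpr hx)
      measurableSet_strictMono]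
    refine Finset.sum_congr rfl fun f _ => ?_
    rw [← Measure.restrict_pi_pi, ← volume_pi, ← increasingBox,
      Measure.restrict_apply (measurableSet_increasingBox f), Set.inter_eq_left.mpr]
    exact fun x hx m _ => (exists_mem_unitTile_iff hn).mp ⟨_, hx.1 m trivial⟩
  rw [h n hn, ← h 1 le_rfl, Fintype.sum_unique, volume_increasingBox]
  · simp [fiberFactorial]
  · exact fun a b _ => le_of_eq (Subsingleton.elim _ _)

lemma toReal_volume_increasingBox {k n : ℕ} (f : Fin k → Fin n) :
    (volume (increasingBox f)).toReal
      = if Monotone f then ((n : ℝ) ^ k)⁻¹ * (fiberFactorial f : ℝ)⁻¹ else 0 := by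
  split_ifs with hf
  · simp [volume_increasingBox hf]
  · simp [increasingBox_eq_empty hf]

lemma volume_increasingBox_ne_top {k n : ℕ} (f : Fin k → Fin n) :
    volume (increasingBox f) ≠ ∞ := by
  refine measure_ne_top_of_subset (s := Set.univ.pi fun m => unitTile n (f m))
    Set.inter_subset_left ?_
  rw [volume_pi_pi]
  exact ENNReal.prod_ne_top fun i _ => by simp [unitTile]

/-- The density of the step permuton with respect to Lebesgue measure. -/
noncomputable def stepDensity (n : ℕ) (M : Matrix (Fin n) (Fin n) ℝ) (p : ℝ × ℝ) : ℝ≥0∞ :=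
  ∑ i : Fin n, ∑ j : Fin n,
    (if p.1 ∈ unitTile n i ∧ p.2 ∈ unitTile n j then ENNReal.ofReal ((n : ℝ) * M i j) else 0)

lemma stepPermuton_eq (n : ℕ) (M : Matrix (Fin n) (Fin n) ℝ) :
    stepPermuton n M = volume.withDensity (stepDensity n M) := by
  unfold stepPermuton stepDensity unitTile
  congr!

lemma measurable_stepDensity (n : ℕ) (M : Matrix (Fin n) (Fin n) ℝ) :
    Measurable (stepDensity n M) := by
  refine Finset.measurable_fun_sum _ fun i _ => Finset.measurable_fun_sum _ fun j _ => ?_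
  exact Measurable.ite ((measurableSet_unitTile i).prod (measurableSet_unitTile j))
    measurable_const measurable_const

lemma stepDensity_ne_top (n : ℕ) (M : Matrix (Fin n) (Fin n) ℝ) (p : ℝ × ℝ) :
    stepDensity n M p ≠ ∞ := by
  refine ENNReal.sum_ne_top.mpr fun i _ => ENNReal.sum_ne_top.mpr fun j _ => ?_
  split_ifs <;> finiteness

instance sigmaFinite_stepPermuton (n : ℕ) (M : Matrix (Fin n) (Fin n) ℝ) :
    SigmaFinite (stepPermuton n M) := by
  rw [stepPermuton_eq]
  exact SigmaFinite.withDensity_of_ne_top' fun p => stepDensity_ne_top n M p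

lemma stepPermuton_restrict (n : ℕ) (M : Matrix (Fin n) (Fin n) ℝ) (i j : Fin n) :
    (stepPermuton n M).restrict (unitTile n i ×ˢ unitTile n j)
      = Real.toNNReal (n * M i j) • volume.restrict (unitTile n i ×ˢ unitTile n j) := by
  have hm := (measurableSet_unitTile i).prod (measurableSet_unitTile j)
  have hc : stepDensity n M =ᵐ[volume.restrict (unitTile n i ×ˢ unitTile n j)]
      fun _ => ENNReal.ofReal (n * M i j) := by
    filter_upwards [ae_restrict_mem hm] with p hp
    rw [stepDensity, Finset.sum_eq_single i, Finset.sum_eq_single j, if_pos ⟨hp.1, hp.2⟩]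
    · exact fun j' _ h => if_neg fun h' => h (unitTile_index_eq h'.2 hp.2)
    · simp
    · exact fun i' _ h => Finset.sum_eq_zero fun j' _ =>
        if_neg fun h' => h (unitTile_index_eq h'.1 hp.1)
    · simp
  rw [stepPermuton_eq, restrict_withDensity hm, withDensity_congr_ae hc, withDensity_const]
  rfl

lemma ae_stepPermuton_mem_tile (n : ℕ) (M : Matrix (Fin n) (Fin n) ℝ) :
    ∀ᵐ p ∂stepPermuton n M, ∃ ij : Fin n × Fin n, p ∈ unitTile n ij.1 ×ˢ unitTile n ij.2 := by
  rw [stepPermuton_eq, ae_withDensity_iff (measurable_stepDensity n M)]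
  refine Filter.Eventually.of_forall fun p hp => ?_
  by_contra hne
  refine hp (Finset.sum_eq_zero fun i _ => Finset.sum_eq_zero fun j _ => if_neg fun h => ?_)
  exact hne ⟨(i, j), h.1, h.2⟩

/-- The tuples already sorted by `x`-coordinate whose `y`-coordinates compare according to `π`. -/
def sortedPatternSet (k : ℕ) (π : Equiv.Perm (Fin k)) : Set (Fin k → ℝ × ℝ) :=
  {p | StrictMono (fun a => (p a).1) ∧ StrictMono (fun a => (p (π.symm a)).2)}

lemma patternSet_eq_biUnion (k : ℕ) (π : Equiv.Perm (Fin k)) :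
    patternSet k π
      = ⋃ σ ∈ (Finset.univ : Finset (Equiv.Perm (Fin k))), {p | p ∘ σ ∈ sortedPatternSet k π} := by
  ext p
  simp only [Finset.mem_univ, Set.iUnion_true, Set.mem_iUnion]
  refine exists_congr fun σ => and_congr_right fun _ => ⟨fun h a b hab => ?_, fun h a b => ?_⟩
  · exact (h _ _).mpr (by simpa using hab)
  · simpa using h.lt_iff_lt (a := π a) (b := π b)

lemma measurableSet_sortedPatternSet (k : ℕ) (π : Equiv.Perm (Fin k)) :
    MeasurableSet (sortedPatternSet k π) := by
  have h1 : Measurable fun (p : Fin k → ℝ × ℝ) a => (p a).1 := by fun_prop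
  have h2 : Measurable fun (p : Fin k → ℝ × ℝ) a => (p (π.symm a)).2 := by fun_prop
  exact (h1 measurableSet_strictMono).inter (h2 measurableSet_strictMono)

lemma volume_box_inter_sortedPatternSet {k n : ℕ} (π : Equiv.Perm (Fin k))
    (f g : Fin k → Fin n) :
    volume (Set.univ.pi (fun m => unitTile n (f m) ×ˢ unitTile n (g (π m)))
        ∩ sortedPatternSet k π)
      = volume (increasingBox f) * volume (increasingBox g) := by
  have hg : volume {y : Fin k → ℝ | y ∘ π.symm ∈ increasingBox g} = volume (increasingBox g) :=
    (measurePreserving_comp_perm (volume : Measure ℝ) π.symm).measure_preimage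
      (measurableSet_increasingBox g).nullMeasurableSet
  rw [← hg, ← Measure.prod_prod, ← Measure.volume_eq_prod,
    ← (volume_measurePreserving_arrowProdEquivProdArrow ℝ ℝ (Fin k)).measure_preimage_equiv]
  congr 1
  ext p
  constructor
  · rintro ⟨hb, h1, h2⟩
    refine ⟨⟨fun m _ => (hb m trivial).1, h1⟩, fun m _ => ?_, h2⟩
    have := (hb (π.symm m) trivial).2
    simp only [Equiv.apply_symm_apply] at this
    exact this
  · rintro ⟨⟨hb1, h1⟩, hb2, h2⟩
    refine ⟨fun m _ => ⟨hb1 m trivial, ?_⟩, h1, h2⟩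
    have := hb2 (π m) trivial
    simp only [Function.comp, Equiv.symm_apply_apply] at this
    exact this

lemma pi_stepPermuton_box {k n : ℕ} (π : Equiv.Perm (Fin k)) (M : Matrix (Fin n) (Fin n) ℝ)
    (f g : Fin k → Fin n) :
    (Measure.pi fun _ : Fin k => stepPermuton n M)
        (Set.univ.pi (fun m => unitTile n (f m) ×ˢ unitTile n (g (π m)))
          ∩ sortedPatternSet k π)
      = (∏ m, ENNReal.ofReal (n * M (f m) (g (π m))))
          * (volume (increasingBox f) * volume (increasingBox g)) := by
  have hA := measurableSet_sortedPatternSet k π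
  rw [Set.inter_comm, ← Measure.restrict_apply hA, Measure.restrict_pi_pi]
  simp_rw [stepPermuton_restrict]
  rw [pi_smul_nnreal, ← Measure.restrict_pi_pi, ← volume_pi, Measure.smul_apply,
    Measure.restrict_apply hA, Set.inter_comm, volume_box_inter_sortedPatternSet,
    ENNReal.smul_def, smul_eq_mul, ENNReal.ofNNReal_finsetProd]
  rfl

lemma pi_stepPermuton_patternSet (k n : ℕ) (π : Equiv.Perm (Fin k))
    (M : Matrix (Fin n) (Fin n) ℝ) :
    (Measure.pi fun _ : Fin k => stepPermuton n M) (patternSet k π)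
      = k.factorial * ∑ f : Fin k → Fin n, ∑ g : Fin k → Fin n,
          (∏ m, ENNReal.ofReal (n * M (f m) (g (π m))))
            * (volume (increasingBox f) * volume (increasingBox g)) := by
  rw [patternSet_eq_biUnion, pi_biUnion_perm _ _ (measurableSet_sortedPatternSet k π)
    fun p σ τ h1 h2 => StrictMono.perm_eq_of_comp (x := fun a => (p a).1) h1.1 h2.1,
    Finset.card_univ, Fintype.card_perm, Fintype.card_fin,
    pi_eq_sum_boxes _ (fun ij : Fin n × Fin n => unitTile n ij.1 ×ˢ unitTile n ij.2)
      (fun ij => (measurableSet_unitTile _).prod (measurableSet_unitTile _))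
      (fun i j x hi hj =>
        Prod.ext (unitTile_index_eq hi.1 hj.1) (unitTile_index_eq hi.2 hj.2))
      (ae_stepPermuton_mem_tile n M) (measurableSet_sortedPatternSet k π),
    ← Fintype.sum_prod_type']
  congr 1
  refine (Fintype.sum_equiv (((Equiv.refl _).prodCongr (π.symm.arrowCongr (Equiv.refl _))).trans
    (Equiv.arrowProdEquivProdArrow (Fin k) (fun _ => Fin n) (fun _ => Fin n)).symm)
    _ _ fun fg => ?_).symm
  exact (pi_stepPermuton_box π M fg.1 fg.2).symm

lemma density_eq_sum (k n : ℕ) (π : Equiv.Perm (Fin k)) (M : Matrix (Fin n) (Fin n) ℝ)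
    (hpos : ∀ i j, 0 ≤ M i j) :
    density k n π M
      = k.factorial * ∑ f : Fin k → Fin n, ∑ g : Fin k → Fin n,
          (∏ m, ((n : ℝ) * M (f m) (g (π m))))
            * ((volume (increasingBox f)).toReal * (volume (increasingBox g)).toReal) := by
  have hfin : ∀ f g : Fin k → Fin n, (∏ m, ENNReal.ofReal (n * M (f m) (g (π m))))
      * (volume (increasingBox f) * volume (increasingBox g)) ≠ ∞ := fun f g =>
    ENNReal.mul_ne_top (ENNReal.prod_ne_top fun _ _ => ENNReal.ofReal_ne_top)
      (ENNReal.mul_ne_top (volume_increasingBox_ne_top f) (volume_increasingBox_ne_top g))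
  rw [density, pi_stepPermuton_patternSet, ENNReal.toReal_mul, ENNReal.toReal_natCast,
    ENNReal.toReal_sum fun f _ => ENNReal.sum_ne_top.mpr fun g _ => hfin f g]
  congr 1
  refine Finset.sum_congr rfl fun f _ => ?_
  rw [ENNReal.toReal_sum fun g _ => hfin f g]
  refine Finset.sum_congr rfl fun g _ => ?_
  rw [ENNReal.toReal_mul, ENNReal.toReal_mul, ENNReal.toReal_prod]
  congr 1
  exact Finset.prod_congr rfl fun m _ =>
    ENNReal.toReal_ofReal (mul_nonneg (Nat.cast_nonneg n) (hpos _ _))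

/-- For a `k`-permutation `π` and a doubly stochastic `n × n` matrix `M`, the density of
`π` in the step permuton `μ[M]` equals
`(k!/n^k) ∑_{f,g : [k]↗[n]} (∏_i |f⁻¹(i)|! |g⁻¹(i)|!)⁻¹ ∏_m M_{f(m), g(π(m))}`,
the sum running over pairs of non-decreasing functions `f, g : [k] → [n]`.
In the special case of the constant matrix `M ≡ 1/n`, this value equals `1/k!`. -/
theorem stmt19 (k n : ℕ) (hk : 1 ≤ k) (hn : 1 ≤ n) (π : Equiv.Perm (Fin k))
    (M : Matrix (Fin n) (Fin n) ℝ)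
    (hpos : ∀ i j, 0 ≤ M i j)
    (hrow : ∀ i : Fin n, ∑ j, M i j = 1) (hcol : ∀ j : Fin n, ∑ i, M i j = 1) :
    density k n π M
      = ((k.factorial : ℝ) / (n : ℝ) ^ k) * ∑ f : Fin k → Fin n, ∑ g : Fin k → Fin n,
          (if Monotone f ∧ Monotone g then
            ((∏ i : Fin n, (((Finset.univ.filter (fun m => f m = i)).card.factorial
                * (Finset.univ.filter (fun m => g m = i)).card.factorial : ℕ) : ℝ))⁻¹
              * ∏ m : Fin k, M (f m) (g (π m)))
          else 0)
    ∧ ((∀ i j, M i j = 1 / n) → density k n π M = 1 / (k.factorial : ℝ)) := by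
  have hn0 : (n : ℝ) ≠ 0 := by exact_mod_cast (Nat.one_le_iff_ne_zero.mp hn)
  refine ⟨?_, fun hM => ?_⟩
  · rw [density_eq_sum k n π M hpos, div_eq_mul_inv, mul_assoc, Finset.mul_sum (a := _⁻¹)]
    congr 1
    refine Finset.sum_congr rfl fun f _ => ?_
    rw [Finset.mul_sum]
    refine Finset.sum_congr rfl fun g _ => ?_
    rw [toReal_volume_increasingBox, toReal_volume_increasingBox]
    by_cases hf : Monotone f <;> by_cases hg : Monotone g <;> simp only [hf, hg, if_true,
      if_false, and_self, and_true, and_false, mul_zero, zero_mul]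
    rw [Finset.prod_mul_distrib, Finset.prod_const, Finset.card_univ, Fintype.card_fin,
      ← Nat.cast_prod, Finset.prod_mul_distrib, ← fiberFactorial, ← fiberFactorial, Nat.cast_mul,
      mul_inv]
    field_simp
  · have hsum : ∑ f : Fin k → Fin n, (volume (increasingBox f)).toReal
        = (k.factorial : ℝ)⁻¹ := by
      rw [← ENNReal.toReal_sum fun f _ => volume_increasingBox_ne_top f,
        sum_volume_increasingBox k n hn, ENNReal.toReal_inv, ENNReal.toReal_natCast]
    have hk0 : (k.factorial : ℝ) ≠ 0 := by exact_mod_cast k.factorial_ne_zero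
    rw [density_eq_sum k n π M hpos]
    simp_rw [hM, mul_one_div_cancel hn0, Finset.prod_const_one, one_mul, ← Finset.mul_sum, hsum,
      ← Finset.sum_mul, hsum]
    field_simp
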